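/- Any two elements of the positive braid monoid B_n^+ admit a least common right-multiple: for all a, b in B_n^+ there exists c in B_n^+ such that a left-divides c, b left-divides c, and c left-divides every common right-multiple of a and b. -/

import Mathlib

/-- In a monoid, `a` left-divides `b` if `b = a * c` for some `c`. -/
def LeftDvd {M : Type*} [Monoid M] (a b : M) : Prop := ∃ c, b = a * c

/-- The braid relations on the free monoid over `Fin (n - 1)`: the index `i : Fin (n - 1)`
stands for the Artin generator `σ_{i+1}` (indices are 0-based), and the relations are
`σ_i σ_j σ_i = σ_j σ_i σ_j` for `|i - j| = 1` and `σ_i σ_j = σ_j σ_i` for `|i - j| ≥ 2`. -/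
def braidRels (n : ℕ) : FreeMonoid (Fin (n - 1)) → FreeMonoid (Fin (n - 1)) → Prop :=
  fun x y =>
    (∃ i j : Fin (n - 1), (i : ℕ) + 1 = (j : ℕ) ∧
        x = .of i * .of j * .of i ∧ y = .of j * .of i * .of j) ∨
    (∃ i j : Fin (n - 1), (i : ℕ) + 2 ≤ (j : ℕ) ∧
        x = .of i * .of j ∧ y = .of j * .of i)

/-- The positive braid monoid `B_n⁺`, presented by the generators `σ_1, …, σ_{n-1}`
and the braid relations. -/
def BraidMonoid (n : ℕ) := PresentedMonoid (braidRels n)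

instance (n : ℕ) : Monoid (BraidMonoid n) :=
  inferInstanceAs (Monoid (PresentedMonoid (braidRels n)))

/-- The generator `σ_{i+1}` of `B_n⁺` (0-based index `i : Fin (n - 1)`). -/
def σ {n : ℕ} (i : Fin (n - 1)) : BraidMonoid n := PresentedMonoid.of (braidRels n) i

namespace BraidMonoid

variable {n : ℕ}

/-- The canonical projection from words in the generators to `B_n⁺`. -/
def ofWord (n : ℕ) : FreeMonoid (Fin (n - 1)) →* BraidMonoid n := PresentedMonoid.mk (braidRels n)

theorem ofWord_of (i : Fin (n - 1)) : ofWord n (.of i) = σ i := rfl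

theorem ofWord_eq_iff {v w : FreeMonoid (Fin (n - 1))} :
    ofWord n v = ofWord n w ↔ ConGen.Rel (braidRels n) v w :=
  Con.eq _

theorem ofWord_surjective : Function.Surjective (ofWord n) := PresentedMonoid.surjective_mk

theorem σ_braid {i j : Fin (n - 1)} (h : (i : ℕ) + 1 = j ∨ (j : ℕ) + 1 = i) :
    σ i * (σ j * σ i) = σ j * (σ i * σ j) := by
  have key : ∀ i j : Fin (n - 1), (i : ℕ) + 1 = j → σ i * (σ j * σ i) = σ j * (σ i * σ j) := by
    intro i j h
    have := ofWord_eq_iff.2 (ConGen.Rel.of (r := braidRels n) _ _ (Or.inl ⟨i, j, h, rfl, rfl⟩))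
    simpa only [map_mul, ofWord_of, mul_assoc] using this
  exact h.elim (key i j) fun h => (key j i h).symm

theorem σ_comm {i j : Fin (n - 1)} (h : (i : ℕ) + 2 ≤ j ∨ (j : ℕ) + 2 ≤ i) :
    σ i * σ j = σ j * σ i := by
  have key : ∀ i j : Fin (n - 1), (i : ℕ) + 2 ≤ j → σ i * σ j = σ j * σ i := by
    intro i j h
    have := ofWord_eq_iff.2 (ConGen.Rel.of (r := braidRels n) _ _ (Or.inr ⟨i, j, h, rfl, rfl⟩))
    simpa only [map_mul, ofWord_of] using this
  exact h.elim (key i j) fun h => (key j i h).symm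

/-- The length homomorphism, sending each generator to `1`. -/
def lengthHom (n : ℕ) : BraidMonoid n →* Multiplicative ℕ :=
  PresentedMonoid.lift (fun _ => Multiplicative.ofAdd 1) (by
    rintro x y (⟨i, j, -, rfl, rfl⟩ | ⟨i, j, -, rfl, rfl⟩) <;> simp)

/-- The length of a positive braid. -/
def length (a : BraidMonoid n) : ℕ := (lengthHom n a).toAdd

theorem length_one : length (1 : BraidMonoid n) = 0 := by
  simp [length]

theorem length_mul (a b : BraidMonoid n) : length (a * b) = length a + length b := by
  simp [length]

theorem length_σ (i : Fin (n - 1)) : length (σ i) = 1 := by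
  rfl

theorem length_ofWord (w : FreeMonoid (Fin (n - 1))) : length (ofWord n w) = w.length := by
  induction w with
  | one => simp [length_one]
  | of i => simp [ofWord_of, length_σ]
  | mul v w ihv ihw => simp [length_mul, ihv, ihw]

theorem eq_one_or_eq_σ_mul (a : BraidMonoid n) : a = 1 ∨ ∃ i b, a = σ i * b := by
  obtain ⟨w, rfl⟩ := ofWord_surjective a
  cases w with
  | one => exact .inl (map_one _)
  | of_mul i w => exact .inr ⟨i, ofWord n w, by rw [map_mul, ofWord_of]⟩

/-- The right complement of `σ i` in the least common right-multiple of `σ i` and `σ j`. -/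
def compl (i j : Fin (n - 1)) : BraidMonoid n :=
  if i = j then 1 else if (i : ℕ) + 1 = j ∨ (j : ℕ) + 1 = i then σ j * σ i else σ j

theorem compl_self (i : Fin (n - 1)) : compl i i = 1 := if_pos rfl

theorem compl_of_adj {i j : Fin (n - 1)} (h : (i : ℕ) + 1 = j ∨ (j : ℕ) + 1 = i) :
    compl i j = σ j * σ i := by
  rw [compl, if_neg (by rintro rfl; omega), if_pos h]

theorem compl_of_far {i j : Fin (n - 1)} (h : (i : ℕ) + 2 ≤ j ∨ (j : ℕ) + 2 ≤ i) :
    compl i j = σ j := by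
  rw [compl, if_neg (by rintro rfl; omega), if_neg (by omega)]

theorem eq_or_adj_or_far (i j : Fin (n - 1)) :
    i = j ∨ ((i : ℕ) + 1 = j ∨ (j : ℕ) + 1 = i) ∨ ((i : ℕ) + 2 ≤ j ∨ (j : ℕ) + 2 ≤ i) := by
  rw [Fin.ext_iff]; omega

theorem σ_mul_compl (i j : Fin (n - 1)) : σ i * compl i j = σ j * compl j i := by
  rcases eq_or_adj_or_far i j with rfl | h | h
  · rfl
  · rw [compl_of_adj h, compl_of_adj h.symm, σ_braid h]
  · rw [compl_of_far h, compl_of_far h.symm, σ_comm h]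

/-- `a` and `b` are right multiples of the two complements of `σ i` and `σ j` by a common factor. -/
def Compatible (i j : Fin (n - 1)) (a b : BraidMonoid n) : Prop :=
  ∃ c, a = compl i j * c ∧ b = compl j i * c

theorem Compatible.symm {i j : Fin (n - 1)} {a b : BraidMonoid n} (h : Compatible i j a b) :
    Compatible j i b a :=
  let ⟨c, h₁, h₂⟩ := h
  ⟨c, h₂, h₁⟩

theorem compatible_self_iff {i : Fin (n - 1)} {a b : BraidMonoid n} :
    Compatible i i a b ↔ a = b := by
  simp [Compatible, compl_self, eq_comm]

theorem compatible_iff_of_adj {i j : Fin (n - 1)} (h : (i : ℕ) + 1 = j ∨ (j : ℕ) + 1 = i)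
    {a b : BraidMonoid n} :
    Compatible i j a b ↔ ∃ c, a = σ j * (σ i * c) ∧ b = σ i * (σ j * c) := by
  simp [Compatible, compl_of_adj h, compl_of_adj h.symm, mul_assoc]

theorem compatible_iff_of_far {i j : Fin (n - 1)} (h : (i : ℕ) + 2 ≤ j ∨ (j : ℕ) + 2 ≤ i)
    {a b : BraidMonoid n} :
    Compatible i j a b ↔ ∃ c, a = σ j * c ∧ b = σ i * c := by
  simp [Compatible, compl_of_far h, compl_of_far h.symm]

theorem σ_braid_mul {i j : Fin (n - 1)} (h : (i : ℕ) + 1 = j ∨ (j : ℕ) + 1 = i)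
    (a : BraidMonoid n) : σ i * (σ j * (σ i * a)) = σ j * (σ i * (σ j * a)) := by
  simpa only [mul_assoc] using congrArg (· * a) (σ_braid h)

theorem σ_comm_mul {i j : Fin (n - 1)} (h : (i : ℕ) + 2 ≤ j ∨ (j : ℕ) + 2 ≤ i)
    (a : BraidMonoid n) : σ i * (σ j * a) = σ j * (σ i * a) := by
  simpa only [mul_assoc] using congrArg (· * a) (σ_comm h)

/-- Compatibility is transitive, given that equalities of shorter positive braids are compatible. -/
theorem Compatible.trans {N : ℕ}
    (K : ∀ (i j : Fin (n - 1)) (a b : BraidMonoid n), length a < N → σ i * a = σ j * b →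
      Compatible i j a b)
    {i j k : Fin (n - 1)} {a b d : BraidMonoid n} (hb : length b ≤ N)
    (hab : Compatible i j a b) (hbd : Compatible j k b d) : Compatible i k a d := by
  have Keq : ∀ (i : Fin (n - 1)) (a b : BraidMonoid n), length a < N → σ i * a = σ i * b →
      a = b := fun i a b ha h => compatible_self_iff.1 (K i i a b ha h)
  -- the case where the extreme generator `k` commutes with both `i` and `j`
  have adj_far_far : ∀ (i j k : Fin (n - 1)) (a b d : BraidMonoid n), length b ≤ N →
      ((i : ℕ) + 1 = j ∨ (j : ℕ) + 1 = i) → ((j : ℕ) + 2 ≤ k ∨ (k : ℕ) + 2 ≤ j) →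
      ((i : ℕ) + 2 ≤ k ∨ (k : ℕ) + 2 ≤ i) →
      Compatible i j a b → Compatible j k b d → Compatible i k a d := by
    intro i j k a b d hb hij hjk hik hab hbd
    rw [compatible_iff_of_adj hij] at hab
    rw [compatible_iff_of_far hjk] at hbd
    rw [compatible_iff_of_far hik]
    obtain ⟨C, rfl, rfl⟩ := hab
    obtain ⟨E, hCE, rfl⟩ := hbd
    simp only [length_mul, length_σ] at hb
    obtain ⟨F, hF, rfl⟩ := (compatible_iff_of_far hik).1
      (K i k _ _ (by simp only [length_mul, length_σ]; omega) hCE)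
    obtain ⟨G, rfl, rfl⟩ := (compatible_iff_of_far hjk).1 (K j k _ _ (by omega) hF)
    exact ⟨σ j * (σ i * G), by rw [σ_comm_mul hik, σ_comm_mul hjk], σ_braid_mul hij.symm G⟩
  -- the case where `k` is the middle generator
  have far_adj_adj : ∀ (i j k : Fin (n - 1)) (a b d : BraidMonoid n), length b ≤ N →
      ((i : ℕ) + 2 ≤ j ∨ (j : ℕ) + 2 ≤ i) → ((j : ℕ) + 1 = k ∨ (k : ℕ) + 1 = j) →
      ((i : ℕ) + 1 = k ∨ (k : ℕ) + 1 = i) →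
      Compatible i j a b → Compatible j k b d → Compatible i k a d := by
    intro i j k a b d hb hij hjk hik hab hbd
    rw [compatible_iff_of_far hij] at hab
    rw [compatible_iff_of_adj hjk] at hbd
    rw [compatible_iff_of_adj hik]
    obtain ⟨C, rfl, rfl⟩ := hab
    obtain ⟨E, hCE, rfl⟩ := hbd
    simp only [length_mul, length_σ] at hb
    obtain ⟨F, rfl, hF⟩ := (compatible_iff_of_adj hik).1 (K i k _ _ (by omega) hCE)
    have hl := congrArg length hF
    simp only [length_mul, length_σ] at hb hl
    obtain ⟨G, rfl, hG⟩ := (compatible_iff_of_far hij.symm).1 (K j i _ _ (by omega) hF)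
    obtain ⟨H, rfl, rfl⟩ := (compatible_iff_of_adj hjk.symm).1 (K k j _ _ (by omega) hG)
    refine ⟨σ j * (σ k * (σ i * H)), ?_, ?_⟩
    · rw [σ_comm_mul hij, σ_braid_mul hjk, σ_braid_mul hik.symm, σ_comm_mul hij]
    · rw [σ_braid_mul hik.symm, σ_comm_mul hij.symm, σ_comm_mul hij H, σ_braid_mul hjk]
  rcases eq_or_adj_or_far i j with rfl | hij | hij
  · rwa [compatible_self_iff.1 hab]
  · rcases eq_or_adj_or_far j k with rfl | hjk | hjk
    · rwa [← compatible_self_iff.1 hbd]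
    · rcases eq_or_adj_or_far i k with rfl | hik | hik
      · rw [compatible_iff_of_adj hij] at hab
        rw [compatible_iff_of_adj hjk] at hbd
        obtain ⟨C, rfl, rfl⟩ := hab
        obtain ⟨E, hCE, rfl⟩ := hbd
        simp only [length_mul, length_σ] at hb
        have h := Keq _ _ _ (by simp only [length_mul, length_σ]; omega) hCE
        rw [Keq _ _ _ (by omega) h, compatible_self_iff]
      · omega
      · rw [compatible_iff_of_adj hij] at hab
        rw [compatible_iff_of_adj hjk] at hbd
        rw [compatible_iff_of_far hik]
        obtain ⟨C, rfl, rfl⟩ := hab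
        obtain ⟨E, hCE, rfl⟩ := hbd
        have hl := congrArg length hCE
        simp only [length_mul, length_σ] at hb hl
        obtain ⟨F, hF, hF'⟩ := (compatible_iff_of_far hik).1
          (K i k _ _ (by simp only [length_mul, length_σ]; omega) hCE)
        obtain ⟨G, rfl, rfl⟩ := (compatible_iff_of_adj hjk).1 (K j k _ _ (by omega) hF)
        obtain ⟨H, rfl, hH⟩ := (compatible_iff_of_adj hij.symm).1 (K j i _ _ (by omega) hF')
        simp only [length_mul, length_σ] at hb hl
        have hGH := Keq _ _ _ (by simp only [length_mul, length_σ]; omega) hH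
        obtain ⟨L, rfl, rfl⟩ := (compatible_iff_of_far hik.symm).1 (K k i _ _ (by omega) hGH)
        refine ⟨σ j * (σ k * (σ i * (σ j * L))), ?_, ?_⟩
        · rw [σ_comm_mul hik, ← σ_braid_mul hij.symm, σ_braid_mul hjk]
        · rw [σ_comm_mul hik.symm, ← σ_braid_mul hjk, σ_braid_mul hij.symm, σ_comm_mul hik]
    · rcases eq_or_adj_or_far i k with rfl | hik | hik
      · omega
      · exact (far_adj_adj k j i d b a hb hjk.symm hij.symm hik.symm hbd.symm hab.symm).symm
      · exact adj_far_far i j k a b d hb hij hjk hik hab hbd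
  · rcases eq_or_adj_or_far j k with rfl | hjk | hjk
    · rwa [← compatible_self_iff.1 hbd]
    · rcases eq_or_adj_or_far i k with rfl | hik | hik
      · omega
      · exact far_adj_adj i j k a b d hb hij hjk hik hab hbd
      · exact (adj_far_far k j i d b a hb hjk.symm hij.symm hik.symm hbd.symm hab.symm).symm
    · rw [compatible_iff_of_far hij] at hab
      rw [compatible_iff_of_far hjk] at hbd
      obtain ⟨C, rfl, rfl⟩ := hab
      obtain ⟨E, hCE, rfl⟩ := hbd
      simp only [length_mul, length_σ] at hb
      have hK := K i k _ _ (by omega) hCE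
      rcases eq_or_adj_or_far i k with rfl | hik | hik
      · rw [compatible_self_iff] at hK ⊢
        rw [hK]
      · rw [compatible_iff_of_adj hik] at hK ⊢
        obtain ⟨F, rfl, rfl⟩ := hK
        refine ⟨σ j * F, ?_, ?_⟩
        · rw [σ_comm_mul hjk, σ_comm_mul hij]
        · rw [σ_comm_mul hij.symm, σ_comm_mul hjk]
      · rw [compatible_iff_of_far hik] at hK ⊢
        obtain ⟨F, rfl, rfl⟩ := hK
        exact ⟨σ j * F, σ_comm_mul hjk F, σ_comm_mul hij.symm F⟩

/-- Garside's key lemma: `σ i` and `σ j` have a least common right-multiple, and left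
multiplication by `σ i` is injective. -/
theorem compatible_of_σ_mul_eq {i j : Fin (n - 1)} {a b : BraidMonoid n}
    (h : σ i * a = σ j * b) : Compatible i j a b := by
  induction hN : length a using Nat.strong_induction_on generalizing i j a b with
  | _ N ih =>
    have K : ∀ (i j : Fin (n - 1)) (a b : BraidMonoid n), length a < N → σ i * a = σ j * b →
        Compatible i j a b := fun i j a b ha hab => ih _ ha hab rfl
    have main : ∀ v w : FreeMonoid (Fin (n - 1)), ConGen.Rel (braidRels n) v w →
        v.length ≤ N + 1 → ∀ i j v' w', v = .of i * v' → w = .of j * w' →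
          Compatible i j (ofWord n v') (ofWord n w') := by
      intro v w hvw
      induction hvw with
      | of v w h =>
        rintro - i j v' w' rfl rfl
        rcases h with ⟨p, q, hpq, hv, hw⟩ | ⟨p, q, hpq, hv, hw⟩
        · rw [mul_assoc] at hv hw
          obtain ⟨rfl, rfl⟩ := List.cons_eq_cons.1 hv
          obtain ⟨rfl, rfl⟩ := List.cons_eq_cons.1 hw
          exact (compatible_iff_of_adj (.inl hpq)).2 ⟨1, by rw [mul_one]; rfl, by rw [mul_one]; rfl⟩
        · obtain ⟨rfl, rfl⟩ := List.cons_eq_cons.1 hv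
          obtain ⟨rfl, rfl⟩ := List.cons_eq_cons.1 hw
          exact (compatible_iff_of_far (.inl hpq)).2 ⟨1, by rw [mul_one]; rfl, by rw [mul_one]; rfl⟩
      | refl v =>
        rintro - i j v' w' rfl h
        obtain ⟨rfl, rfl⟩ := List.cons_eq_cons.1 h
        exact compatible_self_iff.2 rfl
      | symm hvw ih =>
        intro hl i j v' w' hv hw
        have := congrArg length (ofWord_eq_iff.2 hvw)
        rw [length_ofWord, length_ofWord] at this
        exact (ih (by omega) j i w' v' hw hv).symm
      | @trans u v w huv hvw ih₁ ih₂ =>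
        intro hl i k u' w' hu hw
        have hlen := congrArg length (ofWord_eq_iff.2 huv)
        rw [length_ofWord, length_ofWord] at hlen
        cases v with
        | one => simp [hu] at hlen
        | of_mul j v' =>
          refine Compatible.trans K ?_ (ih₁ hl i j u' v' hu rfl)
            (ih₂ (by omega) j k v' w' rfl hw)
          rw [length_ofWord]
          simp only [FreeMonoid.length_mul, FreeMonoid.length_of] at hlen
          omega
      | @mul u v w x huv hwx ih₁ ih₂ =>
        intro hl i j u' w' hu hw
        have hlen := congrArg length (ofWord_eq_iff.2 huv)
        rw [length_ofWord, length_ofWord] at hlen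
        rw [FreeMonoid.length_mul] at hl
        cases u with
        | one =>
          have hv : v = 1 := FreeMonoid.length_eq_zero.1 (by simpa using hlen.symm)
          exact ih₂ (by omega) i j u' w' (by simpa using hu) (by simpa [hv] using hw)
        | of_mul p u =>
          cases v with
          | one => simp at hlen
          | of_mul q v =>
            rw [mul_assoc] at hu hw
            obtain ⟨rfl, rfl⟩ := List.cons_eq_cons.1 hu
            obtain ⟨rfl, rfl⟩ := List.cons_eq_cons.1 hw
            obtain ⟨c, h₁, h₂⟩ := ih₁ (by omega) _ _ _ _ rfl rfl
            refine ⟨c * ofWord n w, ?_, ?_⟩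
            · exact (map_mul (ofWord n) u w).trans (by rw [h₁, mul_assoc])
            · exact (map_mul (ofWord n) v x).trans
                (by rw [h₂, mul_assoc, ofWord_eq_iff.2 hwx])
    obtain ⟨v, rfl⟩ := ofWord_surjective a
    obtain ⟨w, rfl⟩ := ofWord_surjective b
    rw [← ofWord_of, ← ofWord_of, ← map_mul, ← map_mul, ofWord_eq_iff] at h
    rw [length_ofWord] at hN
    exact main _ _ h (by simp; omega) i j v w rfl rfl

theorem σ_mul_left_cancel {i : Fin (n - 1)} {a b : BraidMonoid n} (h : σ i * a = σ i * b) :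
    a = b :=
  compatible_self_iff.1 (compatible_of_σ_mul_eq h)

/-- `c` is a least common right-multiple of `a` and `b`. -/
def IsLeftLcm (a b c : BraidMonoid n) : Prop :=
  LeftDvd a c ∧ LeftDvd b c ∧ ∀ d, LeftDvd a d → LeftDvd b d → LeftDvd c d

theorem leftDvd_trans {a b c : BraidMonoid n} (hab : LeftDvd a b) (hbc : LeftDvd b c) :
    LeftDvd a c := by
  obtain ⟨x, rfl⟩ := hab
  obtain ⟨y, rfl⟩ := hbc
  exact ⟨x * y, mul_assoc _ _ _⟩

theorem leftDvd_mul_left {a b : BraidMonoid n} (c : BraidMonoid n) (h : LeftDvd a b) :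
    LeftDvd (c * a) (c * b) := by
  obtain ⟨x, rfl⟩ := h
  exact ⟨x, (mul_assoc _ _ _).symm⟩

theorem σ_mul_leftDvd_iff {i : Fin (n - 1)} {a b : BraidMonoid n} :
    LeftDvd (σ i * a) (σ i * b) ↔ LeftDvd a b := by
  refine ⟨?_, leftDvd_mul_left _⟩
  rintro ⟨x, hx⟩
  exact ⟨x, σ_mul_left_cancel (by rw [hx, mul_assoc])⟩

theorem IsLeftLcm.σ_mul {a b c : BraidMonoid n} (h : IsLeftLcm a b c) (i : Fin (n - 1)) :
    IsLeftLcm (σ i * a) (σ i * b) (σ i * c) := by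
  refine ⟨leftDvd_mul_left _ h.1, leftDvd_mul_left _ h.2.1, ?_⟩
  rintro d ⟨x, rfl⟩ hb
  rw [mul_assoc, σ_mul_leftDvd_iff] at hb ⊢
  exact h.2.2 _ ⟨x, rfl⟩ hb

theorem isLeftLcm_σ (i j : Fin (n - 1)) : IsLeftLcm (σ i) (σ j) (σ i * compl i j) := by
  refine ⟨⟨_, rfl⟩, ⟨_, σ_mul_compl i j⟩, ?_⟩
  rintro d ⟨x, rfl⟩ ⟨y, hy⟩
  obtain ⟨c, rfl, -⟩ := compatible_of_σ_mul_eq hy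
  exact ⟨c, (mul_assoc _ _ _).symm⟩

/-- Two positive braids with a common right-multiple have a least one. -/
theorem exists_isLeftLcm_of_leftDvd {a b m : BraidMonoid n} (ha : LeftDvd a m)
    (hb : LeftDvd b m) : ∃ c, IsLeftLcm a b c := by
  induction hN : length m using Nat.strong_induction_on generalizing a b m with
  | _ N ih =>
    rcases eq_one_or_eq_σ_mul a with rfl | ⟨i, a, rfl⟩
    · exact ⟨b, ⟨b, (one_mul b).symm⟩, ⟨1, (mul_one b).symm⟩, fun _ _ h => h⟩
    rcases eq_one_or_eq_σ_mul b with rfl | ⟨j, b, rfl⟩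
    · exact ⟨_, ⟨1, (mul_one _).symm⟩, ⟨_, (one_mul _).symm⟩, fun _ h _ => h⟩
    have hi : LeftDvd (σ i) m := leftDvd_trans ⟨a, rfl⟩ ha
    have hj : LeftDvd (σ j) m := leftDvd_trans ⟨b, rfl⟩ hb
    have hL := (isLeftLcm_σ i j).2.2 m hi hj
    obtain ⟨x, rfl⟩ := hi
    obtain ⟨y, hy⟩ := hj
    have hly := congrArg length hy
    simp only [length_mul, length_σ] at hN hly
    obtain ⟨e, he⟩ := ih _ (by omega) (σ_mul_leftDvd_iff.1 ha) (σ_mul_leftDvd_iff.1 hL) rfl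
    have he' := he.σ_mul i
    obtain ⟨f, hf⟩ : LeftDvd (σ j) (σ i * e) :=
      leftDvd_trans ⟨_, σ_mul_compl i j⟩ he'.2.1
    have hem := he'.2.2 _ ha hL
    rw [hy] at hb
    rw [hy, hf] at hem
    obtain ⟨g, hg⟩ := ih _ (by omega) (σ_mul_leftDvd_iff.1 hem) (σ_mul_leftDvd_iff.1 hb) rfl
    have hg' := hg.σ_mul j
    rw [← hf] at hg'
    refine ⟨σ j * g, leftDvd_trans he'.1 hg'.1, hg'.2.1, fun d hda hdb => ?_⟩
    refine hg'.2.2 d (he'.2.2 d hda ?_) hdb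
    exact (isLeftLcm_σ i j).2.2 d (leftDvd_trans ⟨a, rfl⟩ hda) (leftDvd_trans ⟨b, rfl⟩ hdb)

/-- The generators indexed by all natural numbers, those out of range being trivial. -/
def gen (n i : ℕ) : BraidMonoid n := if h : i < n - 1 then σ ⟨i, h⟩ else 1

theorem gen_braid {i : ℕ} (h : i + 1 < n - 1) :
    gen n i * (gen n (i + 1) * gen n i) = gen n (i + 1) * (gen n i * gen n (i + 1)) := by
  rw [gen, gen, dif_pos (by omega), dif_pos h]
  exact σ_braid (.inl rfl)

theorem gen_comm {i j : ℕ} (h : i + 2 ≤ j) : gen n i * gen n j = gen n j * gen n i := by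
  unfold gen
  split_ifs
  · exact σ_comm (.inl h)
  all_goals simp

/-- The product `σ_{k+1} ⋯ σ_{k+m}` of `m` consecutive generators. -/
def run (n k : ℕ) : ℕ → BraidMonoid n
  | 0 => 1
  | m + 1 => run n k m * gen n (k + m)

theorem run_succ_left (k m : ℕ) : run n k (m + 1) = gen n k * run n (k + 1) m := by
  induction m with
  | zero => simp [run]
  | succ m ih => rw [run, ih, run, mul_assoc, Nat.add_right_comm k 1 m, Nat.add_assoc k m 1]

theorem run_mul_gen_of_lt {m j : ℕ} (h : m < j) :
    run n 0 m * gen n j = gen n j * run n 0 m := by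
  induction m with
  | zero => simp [run]
  | succ m ih =>
    rw [run, mul_assoc, Nat.zero_add, gen_comm (by omega), ← mul_assoc, ih (by omega), mul_assoc]

theorem run_mul_gen {m i : ℕ} (hm : m < n) (h : i + 1 < m) :
    run n 0 m * gen n i = gen n (i + 1) * run n 0 m := by
  induction m with
  | zero => omega
  | succ m ih =>
    rcases Nat.lt_or_ge (i + 1) m with hi | hi
    · rw [run, mul_assoc, Nat.zero_add, ← gen_comm (by omega), ← mul_assoc,
        ih (by omega) hi, mul_assoc]
    · obtain rfl : m = i + 1 := by omega
      rw [run, run, Nat.zero_add, Nat.zero_add, mul_assoc, mul_assoc, gen_braid (by omega),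
        ← mul_assoc, run_mul_gen_of_lt (by omega), mul_assoc, mul_assoc]

theorem run_mul_run {m k : ℕ} (hm : m < n) (h : k < m) :
    run n 0 m * run n 0 k = run n 1 k * run n 0 m := by
  induction k with
  | zero => simp [run]
  | succ k ih =>
    rw [run, ← mul_assoc, ih (by omega), mul_assoc, Nat.zero_add, run_mul_gen hm h, run,
      mul_assoc, Nat.add_comm 1 k]

/-- The Garside element on the first `m` generators. -/
def garside (n : ℕ) : ℕ → BraidMonoid n
  | 0 => 1
  | m + 1 => run n 0 (m + 1) * garside n m

theorem garside_mul_gen_of_lt {m j : ℕ} (h : m < j) :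
    garside n m * gen n j = gen n j * garside n m := by
  induction m with
  | zero => simp [garside]
  | succ m ih =>
    rw [garside, mul_assoc, ih (by omega), ← mul_assoc, run_mul_gen_of_lt h, mul_assoc]

theorem garside_mul_gen {m i : ℕ} (hm : m < n) (h : i < m) :
    garside n m * gen n i = gen n (m - 1 - i) * garside n m := by
  induction m generalizing i with
  | zero => omega
  | succ m ih =>
    rcases Nat.lt_or_ge i m with hi | hi
    · rw [garside, mul_assoc, ih (by omega) hi, ← mul_assoc, run_mul_gen hm (by omega), mul_assoc,
        show m - 1 - i + 1 = m + 1 - 1 - i by omega]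
    · obtain rfl : i = m := by omega
      rw [show i + 1 - 1 - i = 0 by omega]
      cases i with
      | zero => simp [garside, run]
      | succ i =>
        have key : run n 0 (i + 2) * run n 0 (i + 2) =
            gen n 0 * (run n 0 (i + 2) * run n 0 (i + 1)) := by
          rw [run_mul_run (k := i + 1) hm (by omega), ← mul_assoc, ← run_succ_left]
        rw [garside, garside, mul_assoc, mul_assoc, garside_mul_gen_of_lt (by omega),
          ← mul_assoc (run n 0 (i + 1)), ← mul_assoc (run n 0 (i + 2))]
        nth_rw 2 [← Nat.zero_add (i + 1)]
        change run n 0 (i + 2) * run n 0 (i + 2) * _ = _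
        rw [key]
        simp only [mul_assoc]

theorem gen_leftDvd_garside {m i : ℕ} (hm : m < n) (h : i < m) :
    LeftDvd (gen n i) (garside n m) := by
  induction m generalizing i with
  | zero => omega
  | succ m ih =>
    cases i with
    | zero => exact ⟨run n 1 m * garside n m, by rw [garside, run_succ_left, mul_assoc]⟩
    | succ i =>
      obtain ⟨x, hx⟩ := ih (by omega) (i := i) (by omega)
      exact ⟨run n 0 (m + 1) * x, by
        rw [garside, hx, ← mul_assoc, run_mul_gen hm h, mul_assoc]⟩

theorem gen_coe (i : Fin (n - 1)) : gen n i = σ i := dif_pos i.2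

theorem σ_leftDvd_garside (i : Fin (n - 1)) : LeftDvd (σ i) (garside n (n - 1)) :=
  gen_coe i ▸ gen_leftDvd_garside (by have := i.2; omega) i.2

theorem exists_σ_mul_garside_pow (i : Fin (n - 1)) (k : ℕ) :
    ∃ j : Fin (n - 1), σ i * garside n (n - 1) ^ k = garside n (n - 1) ^ k * σ j := by
  induction k with
  | zero => exact ⟨i, by simp⟩
  | succ k ih =>
    obtain ⟨j, hj⟩ := ih
    have hj_lt := j.2
    have h := garside_mul_gen (n := n) (m := n - 1) (i := n - 1 - 1 - j) (by omega) (by omega)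
    rw [show n - 1 - 1 - (n - 1 - 1 - (j : ℕ)) = j by omega, gen_coe] at h
    refine ⟨⟨n - 1 - 1 - j, by omega⟩, ?_⟩
    rw [pow_succ, ← mul_assoc, hj, mul_assoc, ← h, ← gen_coe, mul_assoc]

theorem leftDvd_garside_pow {a : BraidMonoid n} {k : ℕ} (h : length a ≤ k) :
    LeftDvd a (garside n (n - 1) ^ k) := by
  induction k generalizing a with
  | zero =>
    rcases eq_one_or_eq_σ_mul a with rfl | ⟨i, a, rfl⟩
    · exact ⟨_, (one_mul _).symm⟩
    · simp [length_mul, length_σ] at h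
  | succ k ih =>
    rcases eq_one_or_eq_σ_mul a with rfl | ⟨i, a, rfl⟩
    · exact ⟨_, (one_mul _).symm⟩
    · simp only [length_mul, length_σ] at h
      obtain ⟨j, hj⟩ := exists_σ_mul_garside_pow i k
      have hdvd := leftDvd_mul_left (garside n (n - 1) ^ k) (σ_leftDvd_garside j)
      rw [← hj, ← pow_succ] at hdvd
      exact leftDvd_trans (leftDvd_mul_left _ (ih (by omega))) hdvd

end BraidMonoid

/-- Any two elements of the positive braid monoid `B_n⁺` admit a least common
right-multiple. -/
theorem braidMonoid_exists_lcm (n : ℕ) (hn : 1 ≤ n) (a b : BraidMonoid n) :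
    ∃ c : BraidMonoid n, LeftDvd a c ∧ LeftDvd b c ∧
      ∀ d : BraidMonoid n, LeftDvd a d → LeftDvd b d → LeftDvd c d := by
  exact BraidMonoid.exists_isLeftLcm_of_leftDvd
    (BraidMonoid.leftDvd_garside_pow (le_max_left a.length b.length))
    (BraidMonoid.leftDvd_garside_pow (le_max_right a.length b.length))
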